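/- The polynomial ring R_S is spanned as a k-module by the ideal I_S together with the good monomials m(τ), τ running over painted stable S-trees; consequently, the combinatorial cohomology ring H*_S = R_S/I_S is spanned over k by the classes [m(τ)] (equivalently, by the classes of the products ∏_{σ ∈ E} l_σ over good families E of painted stable 2-partitions of S). -/

import Mathlib

open scoped Classical
noncomputable section

namespace EMO

/-- `σ` is an unordered 2-partition of the set `X`: two distinct nonempty disjoint parts
whose union is `X`. -/
def IsTwoPartitionOn {γ : Type*} (X : Set γ) (σ : Set (Set γ)) : Prop :=
  ∃ A B : Set γ, σ = {A, B} ∧ A ≠ B ∧ A.Nonempty ∧ B.Nonempty ∧ Disjoint A B ∧ A ∪ B = X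

/-- unordered 2-partition of the whole set. -/
def IsTwoPartition {γ : Type*} (σ : Set (Set γ)) : Prop :=
  IsTwoPartitionOn Set.univ σ

/-- `δ(σ,τ)`: the number of nonempty pairwise distinct sets among the intersections
`A ∩ B`, `A ∈ σ`, `B ∈ τ`, minus 2. -/
def delta {γ : Type*} (σ τ : Set (Set γ)) : ℤ :=
  ({C : Set γ | C.Nonempty ∧ ∃ A ∈ σ, ∃ B ∈ τ, C = A ∩ B}.ncard : ℤ) - 2

/-- `a b σ c d` : the elements `a,b` lie in one part of `σ` and `c,d` in the other. -/
def SplitsPair {γ : Type*} (σ : Set (Set γ)) (a b c d : γ) : Prop :=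
  ∃ A ∈ σ, ∃ B ∈ σ, A ≠ B ∧ a ∈ A ∧ b ∈ A ∧ c ∈ B ∧ d ∈ B

/-- a painted stable 2-partition w.r.t. the set `W` of white elements: each part
contains a white element and has at least two elements. -/
def PaintedStablePart {γ : Type*} (W : Set γ) (σ : Set (Set γ)) : Prop :=
  IsTwoPartition σ ∧ ∀ A ∈ σ, (A ∩ W).Nonempty ∧ 2 ≤ A.ncard

/-- a good family of painted stable 2-partitions: pairwise `δ = 1`. -/
def GoodFamily {γ : Type*} (W : Set γ) (E : Set (Set (Set γ))) : Prop :=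
  (∀ σ ∈ E, PaintedStablePart W σ) ∧ ∀ σ ∈ E, ∀ σ' ∈ E, σ ≠ σ' → delta σ σ' = 1

/-- an allowed quadruple: pairwise distinct, and each of the pairs
`{i,j}`, `{k,l}`, `{k,j}`, `{i,l}` contains a white element. -/
def Allowed {γ : Type*} (W : Set γ) (i j k l : γ) : Prop :=
  i ≠ j ∧ i ≠ k ∧ i ≠ l ∧ j ≠ k ∧ j ≠ l ∧ k ≠ l ∧
  (i ∈ W ∨ j ∈ W) ∧ (k ∈ W ∨ l ∈ W) ∧ (k ∈ W ∨ j ∈ W) ∧ (i ∈ W ∨ l ∈ W)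

/-- `ε(σ; i,j,k,l)`. -/
def eps {γ : Type*} (σ : Set (Set γ)) (i j k l : γ) : ℤ :=
  if SplitsPair σ i j k l then 1 else if SplitsPair σ k j i l then -1 else 0

/-- A tree whose tails are bijectively labeled by `γ`: a finite graph
(vertices, flags, incidence map, involution) whose geometric realization is
connected and simply connected (edge count), together with a labeling of the tails. -/
structure LTree (γ : Type) where
  V : Type
  Fl : Type
  [finV : Finite V]
  [finF : Finite Fl]
  bd : Fl → V
  inv : Fl → Fl
  inv_inv : ∀ f, inv (inv f) = f
  label : γ → Fl
  label_fixed : ∀ s, inv (label s) = label s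
  label_inj : Function.Injective label
  label_surj : ∀ f, inv f = f → ∃ s, label s = f
  conn : ∀ v w : V, Relation.ReflTransGen (fun a b => ∃ f, bd f = a ∧ bd (inv f) = b) v w
  tree_count : Nat.card {f : Fl // inv f ≠ f} + 2 = 2 * Nat.card V

attribute [instance] LTree.finV LTree.finF

namespace LTree

variable {γ : Type} (τ : LTree γ)

/-- flags incident to a vertex. -/
def flagsAt (v : τ.V) : Set τ.Fl := {f | τ.bd f = v}

/-- adjacency avoiding the edge `{f, inv f}`. -/
def sideAdj (f : τ.Fl) (a b : τ.V) : Prop :=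
  ∃ g, g ≠ f ∧ g ≠ τ.inv f ∧ τ.bd g = a ∧ τ.bd (τ.inv g) = b

/-- labels lying on the `f`-side of the edge `{f, inv f}`. -/
def flagSide (f : τ.Fl) : Set γ :=
  {s | Relation.ReflTransGen (τ.sideAdj f) (τ.bd (τ.label s)) (τ.bd f)}

/-- the 2-partition `σ_e` of the labels determined by the edge `{f, inv f}`. -/
def flagPartition (f : τ.Fl) : Set (Set γ) := {τ.flagSide f, τ.flagSide (τ.inv f)}

/-- the family of 2-partitions of labels determined by the edges of `τ`. -/
def edgeFamily : Set (Set (Set γ)) := {σ | ∃ f, τ.inv f ≠ f ∧ τ.flagPartition f = σ}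

/-- painted stability: every vertex carries at least three flags, and every
end vertex carries a white tail. -/
def PaintedStable (W : Set γ) : Prop :=
  (∀ v : τ.V, 3 ≤ Nat.card {f : τ.Fl // τ.bd f = v}) ∧
  (∀ v : τ.V, Nat.card {f : τ.Fl // τ.bd f = v ∧ τ.inv f ≠ f} ≤ 1 →
    ∃ s ∈ W, τ.bd (τ.label s) = v)

/-- adjacency avoiding the vertex `v`. -/
def avoidAdj (v : τ.V) (a b : τ.V) : Prop :=
  a ≠ v ∧ b ≠ v ∧ ∃ g, τ.bd g = a ∧ τ.bd (τ.inv g) = b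

/-- the labels carried by the branch of `τ` at `v` starting with the flag `φ`. -/
def branchLabels (v : τ.V) (φ : τ.Fl) : Set γ :=
  {s | τ.label s = φ ∨
    (τ.inv φ ≠ φ ∧ Relation.ReflTransGen (τ.avoidAdj v) (τ.bd (τ.inv φ)) (τ.bd (τ.label s)))}

/-- the 2-partition of labels induced by a 2-partition `α` of the flags at `v`. -/
def inducedSPart (v : τ.V) (α : Set (Set τ.Fl)) : Set (Set γ) :=
  (fun A => ⋃ φ ∈ A, τ.branchLabels v φ) '' α

/-- painted stable 2-partitions of the set of flags at `v`. -/
def VertexParts (W : Set γ) (v : τ.V) : Set (Set (Set τ.Fl)) :=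
  {α | IsTwoPartitionOn (τ.flagsAt v) α ∧ PaintedStablePart W (τ.inducedSPart v α)}

/-- an allowed quadruple of (pairwise distinct) flags at the vertex `v`: there are
labels on the corresponding branches forming an allowed quadruple. -/
def AllowedFlags (W : Set γ) (v : τ.V) (I J K L : τ.Fl) : Prop :=
  I ∈ τ.flagsAt v ∧ J ∈ τ.flagsAt v ∧ K ∈ τ.flagsAt v ∧ L ∈ τ.flagsAt v ∧
  I ≠ J ∧ I ≠ K ∧ I ≠ L ∧ J ≠ K ∧ J ≠ L ∧ K ≠ L ∧
  ∃ i ∈ τ.branchLabels v I, ∃ j ∈ τ.branchLabels v J,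
    ∃ a ∈ τ.branchLabels v K, ∃ b ∈ τ.branchLabels v L, Allowed W i j a b

end LTree

/-- an `S`-isomorphism of labeled trees (flags mapped in the reverse direction). -/
structure SIso {γ : Type} (τ τ' : LTree γ) where
  vmap : τ.V ≃ τ'.V
  fmap : τ'.Fl ≃ τ.Fl
  bd_comp : ∀ f : τ'.Fl, τ'.bd f = vmap (τ.bd (fmap f))
  inv_comp : ∀ f : τ'.Fl, fmap (τ'.inv f) = τ.inv (fmap f)
  label_comp : ∀ s : γ, fmap (τ'.label s) = τ.label s

/-- a morphism `τ' → τ` of labeled trees contracting the edge `{e₁, inv e₁}` of `τ'`. -/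
structure Contraction {γ : Type} (τ' τ : LTree γ) (e₁ : τ'.Fl) where
  cF : τ.Fl → τ'.Fl
  cV : τ'.V → τ.V
  cF_inj : Function.Injective cF
  cF_range : Set.range cF = {f : τ'.Fl | f ≠ e₁ ∧ f ≠ τ'.inv e₁}
  cF_inv : ∀ f, cF (τ.inv f) = τ'.inv (cF f)
  cF_label : ∀ s : γ, cF (τ.label s) = τ'.label s
  cV_surj : Function.Surjective cV
  cV_bd : ∀ f : τ.Fl, cV (τ'.bd (cF f)) = τ.bd f
  cV_glue : cV (τ'.bd e₁) = cV (τ'.bd (τ'.inv e₁))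
  cV_almost_inj : ∀ v w : τ'.V, cV v = cV w →
    v = w ∨ (({v, w} : Set τ'.V) = {τ'.bd e₁, τ'.bd (τ'.inv e₁)})

/-- the polynomial ring `R_S = k[l_σ]` on variables indexed by painted stable
2-partitions. -/
abbrev PSP (γ : Type) (W : Set γ) := {σ : Set (Set γ) // PaintedStablePart W σ}

abbrev Rring (γ : Type) (W : Set γ) (k : Type) [CommRing k] := MvPolynomial (PSP γ W) k

/-- the variable `l_σ` (or `0` if `σ` is not painted stable). -/
def lvar (γ : Type) (W : Set γ) (k : Type) [CommRing k] (σ : Set (Set γ)) : Rring γ W k :=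
  if h : PaintedStablePart W σ then MvPolynomial.X ⟨σ, h⟩ else 0

/-- the element `R_{ijkl} = Σ_σ ε(σ; i,j,k,l) l_σ`. -/
def Rquad (γ : Type) (W : Set γ) (k : Type) [CommRing k] (i j a b : γ) : Rring γ W k :=
  ∑ᶠ σ : PSP γ W, eps σ.1 i j a b • MvPolynomial.X σ

/-- the ideal `I_S` generated by the `R_{ijkl}` (over allowed quadruples) and the
products `l_σ l_σ'` for crossing pairs `σ, σ'`. -/
def idealI (γ : Type) (W : Set γ) (k : Type) [CommRing k] : Ideal (Rring γ W k) :=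
  Ideal.span
    ({p | ∃ i j a b : γ, Allowed W i j a b ∧ p = Rquad γ W k i j a b} ∪
     {p | ∃ σ σ' : PSP γ W, (∃ i j a b : γ, Allowed W i j a b ∧
        SplitsPair σ.1 i j a b ∧ SplitsPair σ'.1 a j i b) ∧
        p = MvPolynomial.X σ * MvPolynomial.X σ'})

/-- the good monomial `∏_{σ ∈ E} l_σ` of a family `E` of 2-partitions. -/
def mFam (γ : Type) (W : Set γ) (k : Type) [CommRing k] (E : Set (Set (Set γ))) :
    Rring γ W k :=
  ∏ᶠ σ ∈ E, lvar γ W k σ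

/-- the combinatorial cohomology ring `H*_S = R_S/I_S`. -/
abbrev HS (γ : Type) (W : Set γ) (k : Type) [CommRing k] := Rring γ W k ⧸ idealI γ W k

/-- good families of painted stable 2-partitions (= iso classes of painted stable trees). -/
abbrev GoodFam (γ : Type) (W : Set γ) := {E : Set (Set (Set γ)) // GoodFamily W E}

/-- the free `k`-module `M_S` on the iso classes `μ(τ)` of painted stable `S`-trees,
encoded by their families of edge 2-partitions. -/
abbrev MS (γ : Type) (W : Set γ) (k : Type) [CommRing k] := GoodFam γ W →₀ k

/-- the basis element `μ(τ)` of `M_S` attached to the edge family `E` of `τ`. -/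
def muE (γ : Type) (W : Set γ) (k : Type) [CommRing k] (E : Set (Set (Set γ))) : MS γ W k :=
  if h : GoodFamily W E then Finsupp.single ⟨E, h⟩ 1 else 0

/-- the standard relation `r(τ, v; I,J,K,L) = Σ_α ε(α; I,J,K,L) μ(τ(α))`. -/
def stdRelH (γ : Type) (W : Set γ) (k : Type) [CommRing k]
    (τ : LTree γ) (v : τ.V) (I J K L : τ.Fl) : MS γ W k :=
  ∑ᶠ α ∈ τ.VertexParts W v, eps α I J K L • muE γ W k (τ.edgeFamily ∪ {τ.inducedSPart v α})

/-- the span `J_S` of the standard relations. -/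
def JS (γ : Type) (W : Set γ) (k : Type) [CommRing k] : Submodule k (MS γ W k) :=
  Submodule.span k {x | ∃ τ : LTree γ, τ.PaintedStable W ∧ ∃ (v : τ.V) (I J K L : τ.Fl),
    τ.AllowedFlags W v I J K L ∧ x = stdRelH γ W k τ v I J K L}

/-- the combinatorial homology `H_{*S} = M_S/J_S`. -/
abbrev HsLow (γ : Type) (W : Set γ) (k : Type) [CommRing k] := MS γ W k ⧸ JS γ W k

end EMO

namespace EMO

/-! ### Splits and crossings -/

/-- The sets `A` and `B` cross: each of the four cells they cut out is nonempty. -/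
def Crosses {γ : Type*} (A B : Set γ) : Prop :=
  (A ∩ B).Nonempty ∧ (A ∩ Bᶜ).Nonempty ∧ (Aᶜ ∩ B).Nonempty ∧ (Aᶜ ∩ Bᶜ).Nonempty

theorem pair_compl_comm {γ : Type*} (A : Set γ) : ({A, Aᶜ} : Set (Set γ)) = {Aᶜ, Aᶜᶜ} := by
  rw [compl_compl, Set.pair_comm]

theorem compl_pair_eq {γ : Type*} {A B : Set γ} (h : ({A, Aᶜ} : Set (Set γ)) = {B, Bᶜ}) :
    A = B ∨ A = Bᶜ := by
  have : A ∈ ({B, Bᶜ} : Set (Set γ)) := h ▸ Set.mem_insert _ _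
  simpa using this

theorem paintedStablePart_iff {γ : Type*} {W : Set γ} {σ : Set (Set γ)} :
    PaintedStablePart W σ ↔ ∃ A : Set γ, σ = {A, Aᶜ} ∧ (A ∩ W).Nonempty ∧ (Aᶜ ∩ W).Nonempty ∧
      2 ≤ A.ncard ∧ 2 ≤ Aᶜ.ncard := by
  constructor
  · rintro ⟨⟨A, B, rfl, -, -, -, hd, hu⟩, h⟩
    have hB : B = Aᶜ := (IsCompl.of_eq (by simpa using hd.eq_bot) (by simpa using hu)).compl_eq.symm
    subst hB
    have h1 := h A (by simp)
    have h2 := h Aᶜ (by simp)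
    exact ⟨A, rfl, h1.1, h2.1, h1.2, h2.2⟩
  · rintro ⟨A, rfl, h1, h2, h3, h4⟩
    refine ⟨⟨A, Aᶜ, rfl, ?_, h1.mono Set.inter_subset_left, h2.mono Set.inter_subset_left,
      disjoint_compl_right, Set.union_compl_self A⟩, ?_⟩
    · intro h
      obtain ⟨x, hx, -⟩ := h1
      have hx' := hx
      rw [h] at hx'
      exact hx' hx
    · rintro B (rfl | rfl)
      · exact ⟨h1, h3⟩
      · exact ⟨h2, h4⟩

theorem splitsPair_iff {γ : Type*} {A : Set γ} {a b c d : γ} :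
    SplitsPair {A, Aᶜ} a b c d ↔
      (a ∈ A ∧ b ∈ A ∧ c ∉ A ∧ d ∉ A) ∨ (a ∉ A ∧ b ∉ A ∧ c ∈ A ∧ d ∈ A) := by
  constructor
  · rintro ⟨X, rfl | rfl, Y, rfl | rfl, hne, ha, hb, hc, hd⟩
    · exact absurd rfl hne
    · exact Or.inl ⟨ha, hb, hc, hd⟩
    · exact Or.inr ⟨ha, hb, hc, hd⟩
    · exact absurd rfl hne
  · have hne : (∃ x, x ∈ A) → A ≠ Aᶜ := by
      rintro ⟨x, hx⟩ h
      have hx' := hx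
      rw [h] at hx'
      exact hx' hx
    rintro (⟨ha, hb, hc, hd⟩ | ⟨ha, hb, hc, hd⟩)
    · exact ⟨A, by simp, Aᶜ, by simp, hne ⟨a, ha⟩, ha, hb, hc, hd⟩
    · exact ⟨Aᶜ, by simp, A, by simp, (hne ⟨c, hc⟩).symm, ha, hb, hc, hd⟩

theorem not_crosses_of_delta {γ : Type*} {A B : Set γ}
    (h : delta ({A, Aᶜ} : Set (Set γ)) {B, Bᶜ} = 1) : ¬ Crosses A B := by
  rintro ⟨⟨a, ha⟩, ⟨b, hb⟩, ⟨c, hc⟩, ⟨d, hd⟩⟩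
  have hset : {C : Set γ | C.Nonempty ∧ ∃ X ∈ ({A, Aᶜ} : Set (Set γ)),
      ∃ Y ∈ ({B, Bᶜ} : Set (Set γ)), C = X ∩ Y} =
      {A ∩ B, A ∩ Bᶜ, Aᶜ ∩ B, Aᶜ ∩ Bᶜ} := by
    ext C
    constructor
    · rintro ⟨-, X, rfl | rfl, Y, rfl | rfl, rfl⟩ <;> simp
    · rintro (rfl | rfl | rfl | rfl)
      · exact ⟨⟨a, ha⟩, A, by simp, B, by simp, rfl⟩
      · exact ⟨⟨b, hb⟩, A, by simp, Bᶜ, by simp, rfl⟩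
      · exact ⟨⟨c, hc⟩, Aᶜ, by simp, B, by simp, rfl⟩
      · exact ⟨⟨d, hd⟩, Aᶜ, by simp, Bᶜ, by simp, rfl⟩
  have hne : ∀ {X Y : Set γ} {x : γ}, x ∈ X → x ∉ Y → X ≠ Y := fun hx hy h => hy (h ▸ hx)
  rw [delta, hset, Set.ncard_insert_of_notMem, Set.ncard_insert_of_notMem, Set.ncard_pair] at h
  · norm_num at h
  · exact hne hc (fun h => h.2 hc.2)
  · rintro (h | h)
    · exact hne hb (fun h => h.1 hb.1) h
    · exact hne hb (fun h => h.1 hb.1) h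
  · rintro (h | h | h)
    · exact hne ha (fun h => h.2 ha.2) h
    · exact hne ha (fun h => h.1 ha.1) h
    · exact hne ha (fun h => h.1 ha.1) h

theorem delta_of_disjoint {γ : Type*} {A B : Set γ} (hA : A.Nonempty) (hB : B.Nonempty)
    (hne : ({A, Aᶜ} : Set (Set γ)) ≠ {B, Bᶜ}) (hd : A ∩ B = ∅) :
    delta ({A, Aᶜ} : Set (Set γ)) {B, Bᶜ} = 1 := by
  have hAB : A ∩ Bᶜ = A := by
    rw [Set.inter_eq_left, Set.subset_compl_iff_disjoint_right, Set.disjoint_iff_inter_eq_empty, hd]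
  have hBA : Aᶜ ∩ B = B := by
    rw [Set.inter_eq_right, Set.subset_compl_iff_disjoint_left, Set.disjoint_iff_inter_eq_empty, hd]
  have hC : (Aᶜ ∩ Bᶜ).Nonempty := by
    rw [Set.nonempty_iff_ne_empty]
    intro h
    refine hne ?_
    have : B = Aᶜ := by
      apply Set.Subset.antisymm
      · rw [← hBA]; exact Set.inter_subset_left
      · intro x hx
        by_contra hxB
        have : x ∈ Aᶜ ∩ Bᶜ := ⟨hx, hxB⟩
        rw [h] at this
        exact this
    rw [this, compl_compl, Set.pair_comm]
  have hset : {C : Set γ | C.Nonempty ∧ ∃ X ∈ ({A, Aᶜ} : Set (Set γ)),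
      ∃ Y ∈ ({B, Bᶜ} : Set (Set γ)), C = X ∩ Y} = {A, B, Aᶜ ∩ Bᶜ} := by
    ext C
    constructor
    · rintro ⟨hne, X, rfl | rfl, Y, rfl | rfl, rfl⟩
      · rw [hd] at hne; exact absurd hne Set.not_nonempty_empty
      · simp [hAB]
      · simp [hBA]
      · simp
    · rintro (rfl | rfl | rfl)
      · exact ⟨hA, C, by simp, Bᶜ, by simp, hAB.symm⟩
      · exact ⟨hB, Aᶜ, by simp, C, by simp, hBA.symm⟩
      · exact ⟨hC, Aᶜ, by simp, Bᶜ, by simp, rfl⟩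
  have hne' : ∀ {X Y : Set γ} {x : γ}, x ∈ X → x ∉ Y → X ≠ Y := fun hx hy h => hy (h ▸ hx)
  obtain ⟨a, ha⟩ := hA
  obtain ⟨b, hb⟩ := hB
  rw [delta, hset, Set.ncard_insert_of_notMem, Set.ncard_pair]
  · norm_num
  · exact hne' hb (fun h => h.2 hb)
  · rintro (h | h)
    · refine hne' ha (fun h' => ?_) h
      have : a ∈ A ∩ B := ⟨ha, h'⟩
      rw [hd] at this
      exact this
    · exact hne' ha (fun h' => h'.1 ha) h

theorem delta_of_not_crosses {γ : Type*} {A B : Set γ} (hA : A.Nonempty) (hA' : Aᶜ.Nonempty)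
    (hB : B.Nonempty) (hB' : Bᶜ.Nonempty) (hne : ({A, Aᶜ} : Set (Set γ)) ≠ {B, Bᶜ})
    (hc : ¬ Crosses A B) : delta ({A, Aᶜ} : Set (Set γ)) {B, Bᶜ} = 1 := by
  simp only [Crosses, not_and_or, Set.not_nonempty_iff_eq_empty] at hc
  rcases hc with h | h | h | h
  · exact delta_of_disjoint hA hB hne h
  · rw [pair_compl_comm B] at hne ⊢
    exact delta_of_disjoint hA hB' hne h
  · rw [pair_compl_comm A] at hne ⊢
    exact delta_of_disjoint hA' hB hne h
  · rw [pair_compl_comm A, pair_compl_comm B] at hne ⊢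
    exact delta_of_disjoint hA' hB' hne h

theorem Crosses.symm {γ : Type*} {A B : Set γ} (h : Crosses A B) : Crosses B A := by
  obtain ⟨h1, h2, h3, h4⟩ := h
  rw [Crosses, Set.inter_comm B A, Set.inter_comm B Aᶜ, Set.inter_comm Bᶜ A,
    Set.inter_comm Bᶜ Aᶜ]
  exact ⟨h1, h3, h2, h4⟩

theorem GoodFamily.not_crosses {γ : Type*} {W : Set γ} {E : Set (Set (Set γ))}
    (hE : GoodFamily W E) {A B : Set γ} (hA : {A, Aᶜ} ∈ E) (hB : {B, Bᶜ} ∈ E) :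
    ¬ Crosses A B := by
  by_cases h : ({A, Aᶜ} : Set (Set γ)) = {B, Bᶜ}
  · rintro ⟨⟨x, hx⟩, ⟨y, hy⟩, -⟩
    rcases compl_pair_eq h with rfl | rfl
    · exact hy.2 hy.1
    · exact hx.1 hx.2
  · exact not_crosses_of_delta (hE.2 _ hA _ hB h)

theorem GoodFamily.insert_of_not_crosses {γ : Type*} {W : Set γ} {E : Set (Set (Set γ))}
    (hE : GoodFamily W E) {A : Set γ} (hA : PaintedStablePart W {A, Aᶜ})
    (hc : ∀ B : Set γ, {B, Bᶜ} ∈ E → ¬ Crosses A B) :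
    GoodFamily W (insert {A, Aᶜ} E) := by
  have hnon : ∀ {B : Set γ}, PaintedStablePart W {B, Bᶜ} → B.Nonempty ∧ Bᶜ.Nonempty :=
    fun {B} h => ⟨(h.2 B (by simp)).1.mono Set.inter_subset_left,
      (h.2 Bᶜ (by simp)).1.mono Set.inter_subset_left⟩
  refine ⟨?_, ?_⟩
  · rintro σ (rfl | h)
    · exact hA
    · exact hE.1 σ h
  · rintro σ (rfl | h) σ' (rfl | h') hne
    · exact absurd rfl hne
    · obtain ⟨B, rfl, -⟩ := paintedStablePart_iff.1 (hE.1 _ h')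
      have hB := hnon (hE.1 _ h')
      exact delta_of_not_crosses (hnon hA).1 (hnon hA).2 hB.1 hB.2 hne (hc B h')
    · obtain ⟨B, rfl, -⟩ := paintedStablePart_iff.1 (hE.1 _ h)
      have hB := hnon (hE.1 _ h)
      exact delta_of_not_crosses hB.1 hB.2 (hnon hA).1 (hnon hA).2 hne
        (fun h' => hc B h h'.symm)
    · exact hE.2 σ h σ' h' hne

/-- Every point `i` of a part `A` of a good family has a partner in `A` not separated from `i`
by the parts strictly inside `A`. -/
theorem GoodFamily.exists_partner {γ : Type*} [Finite γ] {W : Set γ} {E : Set (Set (Set γ))}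
    (hE : GoodFamily W E) {A : Set γ} (hA : {A, Aᶜ} ∈ E) {i : γ} (hi : i ∈ A) :
    ∃ j ∈ A, j ≠ i ∧ ∀ C : Set γ, {C, Cᶜ} ∈ E → i ∈ C → j ∈ C → ¬ C ⊂ A := by
  have hPA := hE.1 _ hA
  obtain ⟨⟨z, hz, -⟩, -⟩ := hPA.2 Aᶜ (by simp)
  have hcard := (hPA.2 A (by simp)).2
  obtain ⟨C, hC, hmax⟩ := Set.exists_max_image
    {C : Set γ | C = {i} ∨ ({C, Cᶜ} ∈ E ∧ i ∈ C ∧ C ⊂ A)} Set.ncard (Set.toFinite _)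
    ⟨{i}, Or.inl rfl⟩
  have hiC : i ∈ C := by
    rcases hC with rfl | h
    · rfl
    · exact h.2.1
  have hCA : C ⊂ A := by
    rcases hC with rfl | h
    · refine LE.le.ssubset_of_ne (by simpa using hi) ?_
      rintro rfl
      rw [Set.ncard_singleton] at hcard
      omega
    · exact h.2.2
  obtain ⟨j, hj, hjC⟩ := Set.exists_of_ssubset hCA
  refine ⟨j, hj, fun h => hjC (h ▸ hiC), fun C' hC' hi' hj' hss => ?_⟩
  have hle := hmax C' (Or.inr ⟨hC', hi', hss⟩)
  have hsub : C ⊆ C' := by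
    rcases hC with rfl | ⟨h, -, -⟩
    · simpa using hi'
    · intro x hx
      by_contra hx'
      exact hE.not_crosses h hC' ⟨⟨i, hiC, hi'⟩, ⟨x, hx, hx'⟩, ⟨j, hjC, hj'⟩,
        ⟨z, fun h => hz (hCA.1 h), fun h => hz (hss.1 h)⟩⟩
  rw [Set.eq_of_subset_of_ncard_le hsub hle (Set.toFinite _)] at hjC
  exact absurd hj' hjC

/-- A member of a good family is the only member splitting a suitable allowed quadruple. -/
theorem GoodFamily.exists_allowed {γ : Type*} [Finite γ] {W : Set γ} {E : Set (Set (Set γ))}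
    (hE : GoodFamily W E) {σ : Set (Set γ)} (hσ : σ ∈ E) :
    ∃ i j a b : γ, Allowed W i j a b ∧ SplitsPair σ i j a b ∧
      ∀ σ' ∈ E, σ' ≠ σ → ¬ SplitsPair σ' i j a b ∧ ¬ SplitsPair σ' a j i b := by
  obtain ⟨A, rfl, ⟨i, hi, hiW⟩, ⟨a, ha, haW⟩, -⟩ := paintedStablePart_iff.1 (hE.1 σ hσ)
  obtain ⟨j, hj, hji, hjmin⟩ := hE.exists_partner hσ hi
  obtain ⟨b, hb, hba, hbmin⟩ := hE.exists_partner (pair_compl_comm A ▸ hσ) ha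
  have hne : ∀ {x y : γ}, x ∈ A → y ∈ Aᶜ → x ≠ y := fun hx hy h => hy (h ▸ hx)
  refine ⟨i, j, a, b, ⟨hji.symm, hne hi ha, hne hi hb, hne hj ha, hne hj hb, hba.symm,
    Or.inl hiW, Or.inl haW, Or.inl haW, Or.inl hiW⟩,
    splitsPair_iff.2 (Or.inl ⟨hi, hj, ha, hb⟩), fun σ' hσ' hne' => ⟨?_, ?_⟩⟩
  · intro hs
    have key : ∀ C : Set γ, {C, Cᶜ} ∈ E → ({C, Cᶜ} : Set (Set γ)) ≠ {A, Aᶜ} →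
        i ∈ C → j ∈ C → a ∉ C → b ∉ C → False := by
      intro C hC hCA hiC hjC haC hbC
      by_cases h1 : C ⊆ A
      · refine hjmin C hC hiC hjC (h1.ssubset_of_ne ?_)
        rintro rfl
        exact hCA rfl
      by_cases h2 : A ⊆ C
      · refine hbmin Cᶜ (pair_compl_comm C ▸ hC) haC hbC
          ((Set.compl_subset_compl.2 h2).ssubset_of_ne ?_)
        intro h
        rw [compl_inj_iff] at h
        exact hCA (h ▸ rfl)
      · obtain ⟨x, hx, hx'⟩ := Set.not_subset.1 h1
        obtain ⟨y, hy, hy'⟩ := Set.not_subset.1 h2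
        exact hE.not_crosses hσ hC ⟨⟨i, hi, hiC⟩, ⟨y, hy, hy'⟩, ⟨x, hx', hx⟩, ⟨a, ha, haC⟩⟩
    obtain ⟨C, rfl, -⟩ := paintedStablePart_iff.1 (hE.1 σ' hσ')
    rcases splitsPair_iff.1 hs with ⟨h1, h2, h3, h4⟩ | ⟨h1, h2, h3, h4⟩
    · exact key C hσ' hne' h1 h2 h3 h4
    · exact key Cᶜ (pair_compl_comm C ▸ hσ') (pair_compl_comm C ▸ hne') h1 h2
        (fun h => h h3) (fun h => h h4)
  · intro hs
    obtain ⟨C, rfl, -⟩ := paintedStablePart_iff.1 (hE.1 σ' hσ')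
    rcases splitsPair_iff.1 hs with ⟨h1, h2, h3, h4⟩ | ⟨h1, h2, h3, h4⟩
    · exact hE.not_crosses hσ hσ' ⟨⟨j, hj, h2⟩, ⟨i, hi, h3⟩, ⟨a, ha, h1⟩, ⟨b, hb, h4⟩⟩
    · exact hE.not_crosses hσ hσ' ⟨⟨i, hi, h3⟩, ⟨j, hj, h2⟩, ⟨b, hb, h4⟩, ⟨a, ha, h1⟩⟩

/-- Crossing painted stable 2-partitions are separated by an allowed quadruple. -/
theorem Crosses.exists_allowed {γ : Type*} {W : Set γ} {A B : Set γ} (h : Crosses A B)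
    (hA : (A ∩ W).Nonempty) (hA' : (Aᶜ ∩ W).Nonempty)
    (hB : (B ∩ W).Nonempty) (hB' : (Bᶜ ∩ W).Nonempty) :
    ∃ i j a b : γ, Allowed W i j a b ∧ SplitsPair {A, Aᶜ} i j a b ∧
      SplitsPair {B, Bᶜ} a j i b := by
  have pick : ∀ {C : Set γ}, C.Nonempty → ∃ x ∈ C, ∀ y ∈ C, y ∈ W → x ∈ W := by
    intro C hC
    by_cases h : ∃ x ∈ C, x ∈ W
    · obtain ⟨x, hx, hxW⟩ := h
      exact ⟨x, hx, fun _ _ _ => hxW⟩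
    · obtain ⟨x, hx⟩ := hC
      exact ⟨x, hx, fun y hy hyW => absurd ⟨y, hy, hyW⟩ h⟩
  obtain ⟨h1, h2, h3, h4⟩ := h
  obtain ⟨j, hj, hjW⟩ := pick h1
  obtain ⟨i, hi, hiW⟩ := pick h2
  obtain ⟨a, ha, haW⟩ := pick h3
  obtain ⟨b, hb, hbW⟩ := pick h4
  refine ⟨i, j, a, b, ⟨?_, ?_, ?_, ?_, ?_, ?_, ?_, ?_, ?_, ?_⟩,
    splitsPair_iff.2 (Or.inl ⟨hi.1, hj.1, ha.1, hb.1⟩),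
    splitsPair_iff.2 (Or.inl ⟨ha.2, hj.2, hi.2, hb.2⟩)⟩
  · rintro rfl; exact hi.2 hj.2
  · rintro rfl; exact ha.1 hi.1
  · rintro rfl; exact hb.1 hi.1
  · rintro rfl; exact ha.1 hj.1
  · rintro rfl; exact hb.1 hj.1
  · rintro rfl; exact hb.2 ha.2
  · obtain ⟨w, hw, hwW⟩ := hA
    by_cases hwB : w ∈ B
    · exact Or.inr (hjW w ⟨hw, hwB⟩ hwW)
    · exact Or.inl (hiW w ⟨hw, hwB⟩ hwW)
  · obtain ⟨w, hw, hwW⟩ := hA'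
    by_cases hwB : w ∈ B
    · exact Or.inl (haW w ⟨hw, hwB⟩ hwW)
    · exact Or.inr (hbW w ⟨hw, hwB⟩ hwW)
  · obtain ⟨w, hw, hwW⟩ := hB
    by_cases hwA : w ∈ A
    · exact Or.inr (hjW w ⟨hwA, hw⟩ hwW)
    · exact Or.inl (haW w ⟨hwA, hw⟩ hwW)
  · obtain ⟨w, hw, hwW⟩ := hB'
    by_cases hwA : w ∈ A
    · exact Or.inl (hiW w ⟨hwA, hw⟩ hwW)
    · exact Or.inr (hbW w ⟨hwA, hw⟩ hwW)

/-! ### Good monomials span modulo the ideal -/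

section Span

variable {γ : Type} {W : Set γ} {k : Type} [CommRing k] {E : Set (Set (Set γ))}

variable (γ W k) in
/-- The `k`-span of the ideal `I_S` and of the good monomials. -/
def goodSpan : Submodule k (Rring γ W k) :=
  Submodule.span k ((idealI γ W k : Set (Rring γ W k)) ∪
    {p | ∃ E : Set (Set (Set γ)), GoodFamily W E ∧ p = mFam γ W k E})

theorem mem_goodSpan_of_mem_idealI {p : Rring γ W k} (h : p ∈ idealI γ W k) :
    p ∈ goodSpan γ W k :=
  Submodule.subset_span (Or.inl h)

variable [Finite γ]

theorem mFam_insert {σ : Set (Set γ)} (hσ : σ ∉ E) :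
    mFam γ W k (insert σ E) = lvar γ W k σ * mFam γ W k E :=
  finprod_mem_insert _ hσ (Set.toFinite _)

theorem mul_mFam_mem_idealI_of_crosses (hE : GoodFamily W E) {A B : Set γ}
    (hA : PaintedStablePart W {A, Aᶜ}) (hB : {B, Bᶜ} ∈ E) (h : Crosses A B) :
    MvPolynomial.X ⟨{A, Aᶜ}, hA⟩ * mFam γ W k E ∈ idealI γ W k := by
  have hB' := hE.1 _ hB
  obtain ⟨i, j, a, b, hal, h1, h2⟩ := h.exists_allowed (hA.2 A (by simp)).1 (hA.2 Aᶜ (by simp)).1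
    (hB'.2 B (by simp)).1 (hB'.2 Bᶜ (by simp)).1
  have hEins : E = insert {B, Bᶜ} (E \ {{B, Bᶜ}}) := by
    rw [Set.insert_sdiff_singleton, Set.insert_eq_of_mem hB]
  rw [hEins, mFam_insert (by simp), ← mul_assoc, lvar, dif_pos hB']
  exact Ideal.mul_mem_right _ _ (Ideal.subset_span (Or.inr
    ⟨⟨_, hA⟩, ⟨_, hB'⟩, ⟨i, j, a, b, hal, h1, h2⟩, rfl⟩))

theorem X_mul_mFam_mem_of_notMem (hE : GoodFamily W E) (σ : PSP γ W) (hσ : σ.1 ∉ E) :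
    MvPolynomial.X σ * mFam γ W k E ∈ goodSpan γ W k := by
  obtain ⟨σ, hσP⟩ := σ
  obtain ⟨A, rfl, -⟩ := paintedStablePart_iff.1 hσP
  by_cases hc : ∃ B : Set γ, {B, Bᶜ} ∈ E ∧ Crosses A B
  · obtain ⟨B, hB, hAB⟩ := hc
    exact mem_goodSpan_of_mem_idealI (mul_mFam_mem_idealI_of_crosses hE hσP hB hAB)
  · push Not at hc
    refine Submodule.subset_span (Or.inr ⟨_, hE.insert_of_not_crosses hσP hc, ?_⟩)
    rw [mFam_insert hσ, lvar, dif_pos hσP]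

theorem X_mul_mFam_mem (hE : GoodFamily W E) (σ : PSP γ W) :
    MvPolynomial.X σ * mFam γ W k E ∈ goodSpan γ W k := by
  by_cases hσ : σ.1 ∈ E
  swap
  · exact X_mul_mFam_mem_of_notMem hE σ hσ
  obtain ⟨i, j, a, b, hal, hs, hmin⟩ := hE.exists_allowed hσ
  have := Fintype.ofFinite (PSP γ W)
  have hR : Rquad γ W k i j a b * mFam γ W k E ∈ goodSpan γ W k :=
    mem_goodSpan_of_mem_idealI (Ideal.mul_mem_right _ _
      (Ideal.subset_span (Or.inl ⟨i, j, a, b, hal, rfl⟩)))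
  rw [Rquad, finsum_eq_sum_of_fintype, ← Finset.add_sum_erase _ _ (Finset.mem_univ σ), add_mul,
    Finset.sum_mul] at hR
  have h1 : eps σ.1 i j a b = 1 := if_pos hs
  rw [h1, one_smul] at hR
  refine (Submodule.add_mem_iff_left _ (Submodule.sum_mem _ fun σ' hσ' => ?_)).1 hR
  rw [smul_mul_assoc]
  by_cases hσ'E : σ'.1 ∈ E
  · have h0 : eps σ'.1 i j a b = 0 := by
      have := hmin σ'.1 hσ'E (fun h => Finset.ne_of_mem_erase hσ' (Subtype.ext h))
      rw [eps, if_neg this.1, if_neg this.2]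
    rw [h0, zero_smul]
    exact zero_mem _
  · exact zsmul_mem (X_mul_mFam_mem_of_notMem hE σ' hσ'E) _

theorem X_mul_mem_goodSpan (σ : PSP γ W) {p : Rring γ W k} (hp : p ∈ goodSpan γ W k) :
    MvPolynomial.X σ * p ∈ goodSpan γ W k := by
  refine Submodule.span_induction ?_ ?_ ?_ ?_ hp
  · rintro x (hx | ⟨E, hE, rfl⟩)
    · exact mem_goodSpan_of_mem_idealI (Ideal.mul_mem_left _ _ hx)
    · exact X_mul_mFam_mem hE σ
  · rw [mul_zero]
    exact zero_mem _
  · intro x y _ _ hx hy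
    rw [mul_add]
    exact add_mem hx hy
  · intro c x _ hx
    rw [mul_smul_comm]
    exact Submodule.smul_mem _ _ hx

variable (γ W k) in
theorem goodSpan_eq_top : goodSpan γ W k = ⊤ := by
  refine eq_top_iff.2 fun p _ => ?_
  induction p using MvPolynomial.induction_on with
  | C c =>
    have h1 : (1 : Rring γ W k) ∈ goodSpan γ W k :=
      Submodule.subset_span (Or.inr ⟨∅, ⟨by simp, by simp⟩, by simp [mFam]⟩)
    rw [← mul_one (MvPolynomial.C c), ← MvPolynomial.smul_eq_C_mul]
    exact Submodule.smul_mem _ _ h1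
  | add p q hp hq => exact add_mem (hp trivial) (hq trivial)
  | mul_X p σ hp =>
    rw [mul_comm]
    exact X_mul_mem_goodSpan σ (hp trivial)

end Span

/-! ### The tree of a laminar family -/

/-- A laminar family of nonempty sets containing the whole set. -/
structure IsLaminar {γ : Type} (L : Set (Set γ)) : Prop where
  univ_mem : Set.univ ∈ L
  nonempty : ∀ C ∈ L, C.Nonempty
  nested : ∀ C ∈ L, ∀ D ∈ L, ∀ x ∈ C, x ∈ D → C ⊆ D ∨ D ⊆ C

namespace IsLaminar

variable {γ : Type} {L : Set (Set γ)}

theorem exists_least [Finite γ] (hL : IsLaminar L) {P : Set γ → Prop}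
    (hu : ∃ C ∈ L, P C) {x : γ} (hx : ∀ C, P C → x ∈ C) :
    ∃ C : L, P C.1 ∧ ∀ D ∈ L, P D → C.1 ⊆ D := by
  obtain ⟨C, hC, hmin⟩ := Set.exists_min_image {C | C ∈ L ∧ P C} Set.ncard (Set.toFinite _) hu
  refine ⟨⟨C, hC.1⟩, hC.2, fun D hD hPD => ?_⟩
  rcases hL.nested C hC.1 D hD x (hx C hC.2) (hx D hPD) with h | h
  · exact h
  · exact (Set.eq_of_subset_of_ncard_le h (hmin D ⟨hD, hPD⟩) (Set.toFinite _)).symm.subset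

theorem exists_owner [Finite γ] (hL : IsLaminar L) (x : γ) :
    ∃ C : L, x ∈ C.1 ∧ ∀ D ∈ L, x ∈ D → C.1 ⊆ D :=
  hL.exists_least (P := fun C => x ∈ C) ⟨_, hL.univ_mem, Set.mem_univ x⟩ fun _ h => h

variable (hL : IsLaminar L)

/-- The largest member of a laminar family. -/
def root : L := ⟨Set.univ, hL.univ_mem⟩

theorem ne_root_of_ssubset {C D : L} (h : C.1 ⊂ D.1) : C ≠ hL.root := by
  rintro rfl
  exact h.2 (Set.subset_univ _)

variable [Finite γ]

/-- The least member of a laminar family containing `x`. -/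
def owner (x : γ) : L := (hL.exists_owner x).choose

theorem mem_owner (x : γ) : x ∈ (hL.owner x).1 := (hL.exists_owner x).choose_spec.1

theorem owner_subset {x : γ} (D : L) (hx : x ∈ D.1) : (hL.owner x).1 ⊆ D.1 :=
  (hL.exists_owner x).choose_spec.2 D.1 D.2 hx

theorem owner_subset_iff {x : γ} (D : L) : (hL.owner x).1 ⊆ D.1 ↔ x ∈ D.1 :=
  ⟨fun h => h (hL.mem_owner x), hL.owner_subset D⟩

theorem exists_parent (C : L) :
    ∃ P : L, C ≠ hL.root → C.1 ⊂ P.1 ∧ ∀ D ∈ L, C.1 ⊂ D → P.1 ⊆ D := by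
  by_cases h : C = hL.root
  · exact ⟨C, fun h' => absurd h h'⟩
  · obtain ⟨x, hx⟩ := hL.nonempty C.1 C.2
    obtain ⟨P, hP⟩ := hL.exists_least (P := fun D => C.1 ⊂ D) (x := x)
      ⟨_, hL.univ_mem, Set.ssubset_univ_iff.2 fun h' => h (Subtype.ext h')⟩ fun D hD => hD.1 hx
    exact ⟨P, fun _ => hP⟩

/-- The least member of a laminar family strictly containing `C`. -/
def parent (C : L) : L := (hL.exists_parent C).choose

theorem ssubset_parent {C : L} (h : C ≠ hL.root) : C.1 ⊂ (hL.parent C).1 :=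
  ((hL.exists_parent C).choose_spec h).1

theorem parent_subset {C : L} (h : C ≠ hL.root) {D : L} (hD : C.1 ⊂ D.1) :
    (hL.parent C).1 ⊆ D.1 :=
  ((hL.exists_parent C).choose_spec h).2 D.1 D.2 hD

theorem reflTransGen_of_subset {r : L → L → Prop} {T : L} : ∀ {D : L}, D.1 ⊆ T.1 →
    (∀ D' : L, D.1 ⊆ D'.1 → D'.1 ⊂ T.1 → r D' (hL.parent D')) → Relation.ReflTransGen r D T := by
  intro D
  induction D using WellFoundedGT.induction with
  | ind D ih =>
    intro hDT hr
    by_cases h : D = T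
    · rw [h]
    · have hss : D.1 ⊂ T.1 := hDT.ssubset_of_ne fun h' => h (Subtype.ext h')
      have hroot := hL.ne_root_of_ssubset hss
      have hlt := hL.ssubset_parent hroot
      exact .head (hr D subset_rfl hss) (ih _ hlt (hL.parent_subset hroot hss)
        fun D' h1 h2 => hr D' (hlt.1.trans h1) h2)

/-- The tree whose vertices are the members of a laminar family, each one other than the root
being joined to its parent. -/
def tree : LTree γ where
  V := L
  Fl := γ ⊕ ({C : L // C ≠ hL.root} × Bool)
  bd := Sum.elim hL.owner fun p => if p.2 then p.1.1 else hL.parent p.1.1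
  inv := Sum.map id (Prod.map id not)
  inv_inv := by rintro (s | ⟨C, _ | _⟩) <;> rfl
  label := Sum.inl
  label_fixed _ := rfl
  label_inj := Sum.inl_injective
  label_surj := by
    rintro (s | ⟨C, _ | _⟩) h
    · exact ⟨s, rfl⟩
    · simp at h
    · simp at h
  conn v w := by
    have hup : ∀ v : L, Relation.ReflTransGen (fun a b => ∃ f : γ ⊕ ({C : L // C ≠ hL.root} × Bool),
        Sum.elim hL.owner (fun p => if p.2 then p.1.1 else hL.parent p.1.1) f = a ∧
        Sum.elim hL.owner (fun p => if p.2 then p.1.1 else hL.parent p.1.1)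
          (Sum.map id (Prod.map id not) f) = b) v hL.root := fun v =>
      hL.reflTransGen_of_subset (Set.subset_univ _) fun D' _ h =>
        ⟨Sum.inr (⟨D', hL.ne_root_of_ssubset h⟩, true), rfl, rfl⟩
    refine (hup v).trans ((@Relation.ReflTransGen.stdSymm _ _ ⟨?_⟩).symm _ _ (hup w))
    rintro a b ⟨f, ha, hb⟩
    refine ⟨Sum.map id (Prod.map id not) f, hb, ?_⟩
    rw [← ha]
    rcases f with s | ⟨C, _ | _⟩ <;> rfl
  tree_count := by
    have e : {f : γ ⊕ ({C : L // C ≠ hL.root} × Bool) // Sum.map id (Prod.map id not) f ≠ f} ≃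
        {C : L // C ≠ hL.root} × Bool :=
      { toFun := fun f => match f with
          | ⟨Sum.inl _, h⟩ => absurd rfl h
          | ⟨Sum.inr p, _⟩ => p
        invFun := fun p => ⟨Sum.inr p, by rcases p with ⟨C, _ | _⟩ <;> simp⟩
        left_inv := by
          rintro ⟨s | p, h⟩
          · exact absurd rfl h
          · rfl
        right_inv := fun p => rfl }
    have h := Nat.card_congr (Equiv.optionSubtypeNe hL.root)
    rw [Finite.card_option] at h
    rw [Nat.card_congr e, Nat.card_prod, ← h, Nat.card_eq_fintype_card (α := Bool),
      Fintype.card_bool]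
    ring

/-- The tail of the tree of a laminar family labeled by `s`. -/
abbrev tailFlag (s : γ) : hL.tree.Fl := Sum.inl s

/-- The flag at the vertex `C` of the edge joining `C` to its parent. -/
abbrev upFlag (C : {C : L // C ≠ hL.root}) : hL.tree.Fl := Sum.inr (C, true)

/-- The flag at the parent of `C` of the edge joining `C` to its parent. -/
abbrev downFlag (C : {C : L // C ≠ hL.root}) : hL.tree.Fl := Sum.inr (C, false)

theorem subset_iff_of_sideAdj {C : {C : L // C ≠ hL.root}} {β : Bool} {a b : L}
    (h : hL.tree.sideAdj (Sum.inr (C, β)) a b) : a.1 ⊆ C.1.1 ↔ b.1 ⊆ C.1.1 := by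
  obtain ⟨g, h1, h2, ha, hb⟩ := h
  have key : ∀ D : {C : L // C ≠ hL.root}, D ≠ C →
      (D.1.1 ⊆ C.1.1 ↔ (hL.parent D.1).1 ⊆ C.1.1) := fun D hD =>
    ⟨fun h => hL.parent_subset D.2 (h.ssubset_of_ne fun h' => hD (Subtype.ext (Subtype.ext h'))),
      fun h => (hL.ssubset_parent D.2).1.trans h⟩
  have hne : ∀ D : {C : L // C ≠ hL.root}, ∀ β', g = Sum.inr (D, β') → D ≠ C := by
    rintro D β' rfl rfl
    cases β <;> cases β' <;> first | exact h1 rfl | exact h2 rfl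
  subst ha hb
  rcases g with s | ⟨D, _ | _⟩
  · rfl
  · exact (key D (hne D _ rfl)).symm
  · exact key D (hne D _ rfl)

theorem subset_iff_of_reflTransGen {C : {C : L // C ≠ hL.root}} {β : Bool} {a b : L}
    (h : Relation.ReflTransGen (hL.tree.sideAdj (Sum.inr (C, β))) a b) :
    a.1 ⊆ C.1.1 ↔ b.1 ⊆ C.1.1 := by
  induction h with
  | refl => rfl
  | tail _ h ih => exact ih.trans (hL.subset_iff_of_sideAdj h)

theorem sideAdj_parent {C : {C : L // C ≠ hL.root}} {β : Bool} {D : L} (hD : D ≠ hL.root)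
    (hne : D ≠ C.1) : hL.tree.sideAdj (Sum.inr (C, β)) D (hL.parent D) := by
  refine ⟨Sum.inr (⟨D, hD⟩, true), ?_, ?_, rfl, rfl⟩ <;>
  · intro h
    exact hne (congrArg Subtype.val (congrArg Prod.fst (Sum.inr_injective h)))

theorem sideAdj_symm (f : hL.tree.Fl) : Std.Symm (hL.tree.sideAdj f) := by
  refine ⟨?_⟩
  rintro a b ⟨g, h1, h2, ha, hb⟩
  refine ⟨hL.tree.inv g, fun h => h2 ?_, fun h => h1 ?_, hb, ?_⟩
  · rw [← h, hL.tree.inv_inv]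
  · rw [← hL.tree.inv_inv g, h, hL.tree.inv_inv]
  · rw [hL.tree.inv_inv, ha]

theorem flagSide_upFlag (C : {C : L // C ≠ hL.root}) :
    hL.tree.flagSide (hL.upFlag C) = C.1.1 := by
  ext s
  constructor
  · intro h
    exact (hL.owner_subset_iff _).1 ((hL.subset_iff_of_reflTransGen h).2 subset_rfl)
  · intro h
    refine hL.reflTransGen_of_subset (D := hL.owner s) (hL.owner_subset _ h) fun D' _ hss => ?_
    refine hL.sideAdj_parent (hL.ne_root_of_ssubset hss) ?_
    rintro rfl
    exact hss.2 subset_rfl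

theorem flagSide_downFlag (C : {C : L // C ≠ hL.root}) :
    hL.tree.flagSide (hL.downFlag C) = C.1.1ᶜ := by
  have hroot : ∀ D : L, ¬ D.1 ⊆ C.1.1 →
      Relation.ReflTransGen (hL.tree.sideAdj (hL.downFlag C)) D hL.root := fun D hD =>
    hL.reflTransGen_of_subset (Set.subset_univ _) fun D' h hss =>
      hL.sideAdj_parent (hL.ne_root_of_ssubset hss) fun h' => hD (h' ▸ h)
  have hpar : ¬ (hL.parent C.1).1 ⊆ C.1.1 := (hL.ssubset_parent C.2).2
  ext s
  constructor
  · intro h hs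
    exact hpar ((hL.subset_iff_of_reflTransGen h).1 (hL.owner_subset _ hs))
  · intro h
    exact (hroot (hL.owner s) fun h' => h ((hL.owner_subset_iff _).1 h')).trans
      ((@Relation.ReflTransGen.stdSymm _ _ (hL.sideAdj_symm _)).symm _ _ (hroot _ hpar))

theorem flagPartition_upFlag (C : {C : L // C ≠ hL.root}) :
    hL.tree.flagPartition (hL.upFlag C) = {C.1.1, C.1.1ᶜ} :=
  congrArg₂ (fun A B : Set γ => ({A, B} : Set (Set γ)))
    (hL.flagSide_upFlag C) (hL.flagSide_downFlag C)

theorem flagPartition_downFlag (C : {C : L // C ≠ hL.root}) :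
    hL.tree.flagPartition (hL.downFlag C) = {C.1.1, C.1.1ᶜ} :=
  (congrArg₂ (fun A B : Set γ => ({A, B} : Set (Set γ)))
    (hL.flagSide_downFlag C) (hL.flagSide_upFlag C)).trans
    (Set.pair_comm _ _)

theorem edgeFamily_tree :
    hL.tree.edgeFamily = {σ | ∃ C : {C : L // C ≠ hL.root}, σ = {C.1.1, C.1.1ᶜ}} := by
  ext σ
  constructor
  · rintro ⟨s | ⟨C, _ | _⟩, hf, rfl⟩
    · exact absurd rfl hf
    · exact ⟨C, hL.flagPartition_downFlag C⟩
    · exact ⟨C, hL.flagPartition_upFlag C⟩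
  · rintro ⟨C, rfl⟩
    exact ⟨hL.upFlag C, by simp [tree], hL.flagPartition_upFlag C⟩

theorem exists_flag_toward {C : L} {x : γ} (hx : x ∈ C.1) :
    ∃ f : hL.tree.Fl, hL.tree.bd f = C ∧ (f = hL.tailFlag x ∨
      ∃ D : {C : L // C ≠ hL.root}, f = hL.downFlag D ∧ x ∈ D.1.1 ∧ D.1.1 ⊂ C.1) := by
  by_cases h : hL.owner x = C
  · exact ⟨Sum.inl x, h, Or.inl rfl⟩
  · have hss : (hL.owner x).1 ⊂ C.1 :=
      (hL.owner_subset C hx).ssubset_of_ne fun h' => h (Subtype.ext h')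
    obtain ⟨D, ⟨hxD, hDC⟩, hmax⟩ := Set.exists_max_image {D : L | x ∈ D.1 ∧ D.1 ⊂ C.1}
      (fun D => D.1.ncard) (Set.toFinite _) ⟨_, hL.mem_owner x, hss⟩
    have hD := hL.ne_root_of_ssubset hDC
    refine ⟨Sum.inr (⟨D, hD⟩, false), ?_, Or.inr ⟨⟨D, hD⟩, rfl, hxD, hDC⟩⟩
    by_contra hne
    have hlt := hL.ssubset_parent hD
    have := hmax (hL.parent D) ⟨hlt.1 hxD, (hL.parent_subset hD hDC).ssubset_of_ne
      fun h' => hne (Subtype.ext h')⟩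
    exact absurd (Set.ncard_lt_ncard hlt (Set.toFinite _)) (not_lt.2 this)

theorem exists_downFlag_of_white {W : Set γ} {C : L}
    (hC : ∀ s ∈ W, hL.owner s ≠ C) {w : γ} (hw : w ∈ C.1) (hwW : w ∈ W) :
    ∃ D : {C : L // C ≠ hL.root}, hL.tree.bd (hL.downFlag D) = C ∧ w ∈ D.1.1 := by
  obtain ⟨f, hf, rfl | ⟨D, rfl, hD, -⟩⟩ := hL.exists_flag_toward hw
  · exact absurd hf (hC w hwW)
  · exact ⟨D, hf, hD⟩

theorem paintedStable_tree {W : Set γ} (h3 : 3 ≤ Nat.card γ) (hW : W.Nonempty) {r : γ}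
    (hr : ∀ C ∈ L, C ≠ Set.univ → r ∉ C)
    (hst : ∀ C ∈ L, C ≠ Set.univ → PaintedStablePart W {C, Cᶜ}) :
    hL.tree.PaintedStable W := by
  have hne : ∀ {C : L}, C ≠ hL.root → C.1 ≠ Set.univ := fun h h' => h (Subtype.ext h')
  have hcard : ∀ C : L, C ≠ hL.root → 2 ≤ C.1.ncard ∧ 2 ≤ C.1ᶜ.ncard := fun C hC =>
    ⟨((hst C.1 C.2 (hne hC)).2 C.1 (by simp)).2, ((hst C.1 C.2 (hne hC)).2 C.1ᶜ (by simp)).2⟩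
  have hthree : ∀ x : γ, ∃ y, y ≠ x ∧ y ≠ r := by
    intro x
    by_contra! h
    have : (Set.univ : Set γ) ⊆ {x, r} := fun y _ => by
      by_cases hy : y = x
      · exact Or.inl hy
      · exact Or.inr (h y hy)
    have := (Set.ncard_le_ncard this (Set.toFinite _)).trans (Set.ncard_insert_le _ _)
    rw [Set.ncard_univ, Set.ncard_singleton] at this
    omega
  have hsecond : ∀ C : L, ∀ x : γ, ∃ y ∈ C.1, y ≠ x ∧ y ≠ r := by
    intro C x
    by_cases hC : C = hL.root
    · subst hC
      obtain ⟨y, hy⟩ := hthree x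
      exact ⟨y, Set.mem_univ y, hy⟩
    · obtain ⟨y, hy, hyx⟩ := Set.exists_ne_of_one_lt_ncard (hcard C hC).1 x
      exact ⟨y, hy, hyx, fun h => hr C.1 C.2 (hne hC) (h ▸ hy)⟩
  have houtside : ∀ C : L, ∀ D : {C : L // C ≠ hL.root}, D.1.1 ⊂ C.1 →
      ∃ y ∈ C.1, y ∉ D.1.1 ∧ y ≠ r := by
    intro C D hDC
    by_cases hC : C = hL.root
    · subst hC
      obtain ⟨y, hy, hyr⟩ := Set.exists_ne_of_one_lt_ncard (hcard D.1 D.2).2 r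
      exact ⟨y, Set.mem_univ y, hy, hyr⟩
    · obtain ⟨y, hy, hyD⟩ := Set.exists_of_ssubset hDC
      exact ⟨y, hy, hyD, fun h => hr C.1 C.2 (hne hC) (h ▸ hy)⟩
  constructor
  · intro C
    change L at C
    obtain ⟨g, hg, hgr⟩ : ∃ g : hL.tree.Fl, hL.tree.bd g = C ∧
        (g = hL.tailFlag r ∨ ∃ D, g = hL.upFlag D) := by
      by_cases hC : C = hL.root
      · refine ⟨Sum.inl r, ?_, Or.inl rfl⟩
        change hL.owner r = C
        rw [hC]
        by_contra h
        exact hr _ (hL.owner r).2 (hne h) (hL.mem_owner r)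
      · exact ⟨hL.upFlag ⟨C, hC⟩, rfl, Or.inr ⟨_, rfl⟩⟩
    have hgf : ∀ {f : hL.tree.Fl} {x : γ}, x ≠ r → (f = hL.tailFlag x ∨
        ∃ D : {C : L // C ≠ hL.root}, f = hL.downFlag D ∧ x ∈ D.1.1 ∧ D.1.1 ⊂ C.1) →
        g ≠ f := by
      rintro f x hx (rfl | ⟨D, rfl, -⟩) rfl
      · rcases hgr with h | ⟨D, h⟩
        · exact hx (Sum.inl_injective h)
        · cases h
      · rcases hgr with h | ⟨D, h⟩ <;> cases h
    obtain ⟨x, hxC, hxr, -⟩ := hsecond C r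
    obtain ⟨f, hf, hfx⟩ := hL.exists_flag_toward hxC
    obtain ⟨y, hyC, hyr, hyf⟩ : ∃ y ∈ C.1, y ≠ r ∧ ∀ f' : hL.tree.Fl, (f' = hL.tailFlag y ∨
        ∃ D : {C : L // C ≠ hL.root}, f' = hL.downFlag D ∧ y ∈ D.1.1 ∧ D.1.1 ⊂ C.1) →
        f ≠ f' := by
      rcases hfx with rfl | ⟨D, rfl, -, hDC⟩
      · obtain ⟨y, hy, hyx, hyr⟩ := hsecond C x
        refine ⟨y, hy, hyr, ?_⟩
        rintro f' (rfl | ⟨D, rfl, -⟩) h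
        · exact hyx (Sum.inl_injective h).symm
        · cases h
      · obtain ⟨y, hy, hyD, hyr⟩ := houtside C D hDC
        refine ⟨y, hy, hyr, ?_⟩
        rintro f' (rfl | ⟨D', rfl, hyD', -⟩) h
        · cases h
        · cases h
          exact hyD hyD'
    obtain ⟨f', hf', hfy⟩ := hL.exists_flag_toward hyC
    have := Fintype.ofFinite {f : hL.tree.Fl // hL.tree.bd f = C}
    rw [Nat.card_eq_fintype_card]
    refine Fintype.two_lt_card_iff.2 ⟨⟨g, hg⟩, ⟨f, hf⟩, ⟨f', hf'⟩, ?_, ?_, ?_⟩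
    · exact fun h => hgf hxr hfx (congrArg Subtype.val h)
    · exact fun h => hgf hyr hfy (congrArg Subtype.val h)
    · exact fun h => hyf f' hfy (congrArg Subtype.val h)
  · intro C hend
    change L at C
    by_contra hno
    have hno' : ∀ s ∈ W, hL.owner s ≠ C := fun s hs h => hno ⟨s, hs, h⟩
    have htwo : ∀ f f' : hL.tree.Fl, hL.tree.bd f = C → hL.tree.bd f' = C →
        hL.tree.inv f ≠ f → hL.tree.inv f' ≠ f' → f = f' := by
      intro f f' h1 h2 h3 h4
      have := Finite.card_le_one_iff_subsingleton.1 hend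
      exact congrArg Subtype.val (Subsingleton.elim
        (⟨f, h1, h3⟩ : {f : hL.tree.Fl // hL.tree.bd f = C ∧ hL.tree.inv f ≠ f}) ⟨f', h2, h4⟩)
    have hinv : ∀ p, hL.tree.inv (Sum.inr p) ≠ Sum.inr p := by
      rintro ⟨D, _ | _⟩ <;> simp [tree]
    by_cases hC : C = hL.root
    · subst hC
      obtain ⟨w, hw⟩ := hW
      obtain ⟨D, hD, hwD⟩ := hL.exists_downFlag_of_white hno' (Set.mem_univ w) hw
      obtain ⟨w', hw'D, hw'⟩ := ((hst D.1.1 D.1.2 (hne D.2)).2 D.1.1ᶜ (by simp)).1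
      obtain ⟨D', hD', hwD'⟩ := hL.exists_downFlag_of_white hno' (Set.mem_univ w') hw'
      have h := htwo _ _ hD hD' (hinv _) (hinv _)
      cases h
      exact hw'D hwD'
    · obtain ⟨w, hwC, hw⟩ := ((hst C.1 C.2 (hne hC)).2 C.1 (by simp)).1
      obtain ⟨D, hD, -⟩ := hL.exists_downFlag_of_white hno' hwC hw
      have h := htwo (hL.upFlag ⟨C, hC⟩) _ rfl hD (hinv _) (hinv _)
      cases h

end IsLaminar

/-- Every good family is the edge family of a painted stable tree. -/
theorem GoodFamily.exists_tree {γ : Type} [Finite γ] {W : Set γ} (h3 : 3 ≤ Nat.card γ)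
    (hW : W.Nonempty) {E : Set (Set (Set γ))} (hE : GoodFamily W E) :
    ∃ τ : LTree γ, τ.PaintedStable W ∧ τ.edgeFamily = E := by
  obtain ⟨r, -⟩ := id hW
  have hmem : ∀ {C : Set γ}, C ∈ insert Set.univ {C : Set γ | {C, Cᶜ} ∈ E ∧ r ∉ C} →
      C ≠ Set.univ → {C, Cᶜ} ∈ E ∧ r ∉ C := fun h hne => h.resolve_left hne
  have hL : IsLaminar (insert Set.univ {C : Set γ | {C, Cᶜ} ∈ E ∧ r ∉ C}) := by
    refine ⟨Set.mem_insert _ _, ?_, ?_⟩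
    · rintro C (rfl | ⟨hC, -⟩)
      · exact ⟨r, trivial⟩
      · exact ((hE.1 _ hC).2 C (by simp)).1.mono Set.inter_subset_left
    · rintro C (rfl | ⟨hC, hrC⟩) D (rfl | ⟨hD, hrD⟩) x hxC hxD
      · exact Or.inl subset_rfl
      · exact Or.inr (Set.subset_univ _)
      · exact Or.inl (Set.subset_univ _)
      · by_contra! h
        obtain ⟨y, hy, hy'⟩ := Set.not_subset.1 h.1
        obtain ⟨z, hz, hz'⟩ := Set.not_subset.1 h.2
        exact hE.not_crosses hC hD ⟨⟨x, hxC, hxD⟩, ⟨y, hy, hy'⟩, ⟨z, hz', hz⟩, ⟨r, hrC, hrD⟩⟩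
  refine ⟨hL.tree, hL.paintedStable_tree h3 hW (r := r) (fun C hC hne => (hmem hC hne).2)
    (fun C hC hne => hE.1 _ (hmem hC hne).1), ?_⟩
  rw [hL.edgeFamily_tree]
  have hroot : ∀ C : Set γ, (hC : {C, Cᶜ} ∈ E) → (hrC : r ∉ C) →
      (⟨C, Or.inr ⟨hC, hrC⟩⟩ : ↥(insert Set.univ {C : Set γ | {C, Cᶜ} ∈ E ∧ r ∉ C})) ≠
        hL.root := by
    intro C hC hrC h
    have h' : C = Set.univ := congrArg Subtype.val h
    exact hrC (h' ▸ Set.mem_univ r)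
  ext σ
  constructor
  · rintro ⟨C, rfl⟩
    exact (hmem C.1.2 fun h => C.2 (Subtype.ext h)).1
  · intro hσ
    obtain ⟨A, rfl, -⟩ := paintedStablePart_iff.1 (hE.1 σ hσ)
    by_cases hrA : r ∈ A
    · have hσ' := pair_compl_comm A ▸ hσ
      exact ⟨⟨_, hroot Aᶜ hσ' fun h => h hrA⟩, pair_compl_comm A⟩
    · exact ⟨⟨_, hroot A hσ hrA⟩, rfl⟩

/-- `R_S` is spanned as a `k`-module by `I_S` together with the good
monomials `m(τ)`; consequently `H*_S = R_S/I_S` is spanned by the classes `[m(τ)]`,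
equivalently by the classes of the products `∏_{σ ∈ E} l_σ` over good families `E`. -/
theorem span_good_monomials {γ : Type} [Finite γ] (W : Set γ)
    (k : Type) [CommRing k]
    (h3 : 3 ≤ Nat.card γ) (hW : 2 ≤ W.ncard) :
    (Submodule.span k ((idealI γ W k : Set (Rring γ W k)) ∪
      {p | ∃ τ : LTree γ, τ.PaintedStable W ∧ p = mFam γ W k τ.edgeFamily}) = ⊤) ∧
    (Submodule.span k {h : HS γ W k | ∃ τ : LTree γ, τ.PaintedStable W ∧
      h = Ideal.Quotient.mk (idealI γ W k) (mFam γ W k τ.edgeFamily)} = ⊤) ∧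
    (Submodule.span k {h : HS γ W k | ∃ E : Set (Set (Set γ)), GoodFamily W E ∧
      h = Ideal.Quotient.mk (idealI γ W k) (mFam γ W k E)} = ⊤) := by
  have htree : ∀ {E : Set (Set (Set γ))}, GoodFamily W E →
      ∃ τ : LTree γ, τ.PaintedStable W ∧ τ.edgeFamily = E := fun hE =>
    hE.exists_tree h3 (Set.nonempty_of_ncard_ne_zero (by omega))
  have hquot : ∀ T : Set (HS γ W k), (∀ E : Set (Set (Set γ)), GoodFamily W E →
      Ideal.Quotient.mk (idealI γ W k) (mFam γ W k E) ∈ T) → Submodule.span k T = ⊤ := by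
    intro T hT
    refine eq_top_iff.2 fun h _ => ?_
    obtain ⟨p, rfl⟩ := Ideal.Quotient.mk_surjective h
    have hp : p ∈ goodSpan γ W k := goodSpan_eq_top γ W k ▸ Submodule.mem_top
    have hle : goodSpan γ W k ≤ (Submodule.span k T).comap
        (Ideal.Quotient.mkₐ k (idealI γ W k)).toLinearMap := by
      refine Submodule.span_le.2 ?_
      rintro q (hq | ⟨E, hE, rfl⟩)
      · have h0 : Ideal.Quotient.mk (idealI γ W k) q = 0 := Ideal.Quotient.eq_zero_iff_mem.2 hq
        simp [h0]
      · exact Submodule.subset_span (hT E hE)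
    exact hle hp
  refine ⟨?_, hquot _ ?_, hquot _ fun E hE => ⟨E, hE, rfl⟩⟩
  · rw [← goodSpan_eq_top γ W k]
    refine le_antisymm (goodSpan_eq_top γ W k ▸ le_top) (Submodule.span_mono ?_)
    rintro p (hp | ⟨E, hE, rfl⟩)
    · exact Or.inl hp
    · obtain ⟨τ, hτ, rfl⟩ := htree hE
      exact Or.inr ⟨τ, hτ, rfl⟩
  · intro E hE
    obtain ⟨τ, hτ, rfl⟩ := htree hE
    exact ⟨τ, hτ, rfl⟩

end EMO
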